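/- Let g be a 3-dimensional left Leibniz algebra over ℂ that is not a Lie algebra and is not nilpotent. Suppose g has a 2-dimensional subspace N spanned by n_1, n_2 with [n_i,n_j] = 0 and [g,g] ⊆ N. Then there exists a basis {n_1, n_2, x} of g, with n_1, n_2 spanning N, in which the brackets [x,n_i] = Σ_j L_{ij} n_j, [n_i,x] = Σ_j R_{ij} n_j, [x,x] = σ_1 n_1 + σ_2 n_2 are given by one of the following five families: (2.1) R = 0, L = [[1,0],[0,0]], σ_1 = 0, σ_2 ∈ ℂ; (2.2) R = 0, L = [[1,0],[0,a]] with a ≠ 0, σ_1 = σ_2 = 0; (2.3) R = 0, L = [[1,1],[0,1]], σ_1 = σ_2 = 0; (2.4) R = [[1,0],[0,0]], L = [[−1,0],[0,a]] with a ≠ 0, σ_1 ∈ ℂ, σ_2 = 0; (2.5) R = [[1,0],[0,0]], L = −R, σ_1, σ_2 ∈ ℂ not both zero. -/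

import Mathlib

section PlaneEndomorphisms

variable {K V : Type*} [Field K] [AddCommGroup V] [Module K V]

theorem exists_smul_add_smul_eq_of_finrank_eq_two (hV : Module.finrank K V = 2) {v w : V}
    (h : LinearIndependent K ![v, w]) (u : V) : ∃ a b : K, a • v + b • w = u := by
  have htop := h.span_eq_top_of_card_eq_finrank (by simp [hV])
  rw [Matrix.range_cons_cons_empty] at htop
  exact Submodule.mem_span_pair.1 (htop ▸ Submodule.mem_top)

/-- Jordan normal form, up to scaling, of a non-nilpotent endomorphism of a plane. -/
theorem exists_jordan_pair_of_not_nilpotent [IsAlgClosed K] (hV : Module.finrank K V = 2)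
    (f : Module.End K V) (hf : ∃ u, f (f u) ≠ 0) :
    ∃ (v w : V) (c : K), c ≠ 0 ∧ LinearIndependent K ![v, w] ∧ f v ≠ 0 ∧
      ((∃ a : K, f v = c • v ∧ f w = a • w) ∨ (f v = c • (v + w) ∧ f w = c • w)) := by
  have : Module.Finite K V := Module.finite_of_finrank_eq_succ hV
  have : Nontrivial V := Module.nontrivial_of_finrank_eq_succ hV
  suffices h : ∃ (v w : V) (c : K), c ≠ 0 ∧ LinearIndependent K ![v, w] ∧
      ((∃ a : K, f v = c • v ∧ f w = a • w) ∨ (f v = c • (v + w) ∧ f w = c • w)) by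
    obtain ⟨v, w, c, hc, hvw, h⟩ := h
    refine ⟨v, w, c, hc, hvw, ?_, h⟩
    rw [LinearIndependent.pair_iff] at hvw
    intro h0
    rcases h with ⟨a, hv, -⟩ | ⟨hv, -⟩
    · exact hc (hvw c 0 (by rw [← hv.symm.trans h0]; module)).1
    · exact hc (hvw c c (by rw [← hv.symm.trans h0]; module)).1
  obtain ⟨b, hb⟩ := Module.End.exists_eigenvalue f
  obtain ⟨w, hw⟩ := hb.exists_hasEigenvector
  have hfw : f w = b • w := hw.apply_eq_smul
  obtain ⟨v, hwv⟩ := exists_linearIndependent_pair_of_one_lt_finrank (R := K)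
    (by omega : 1 < Module.finrank K V) hw.2
  have hvw : LinearIndependent K ![v, w] := LinearIndependent.pair_symm_iff.1 hwv
  obtain ⟨c, d, hfv⟩ := exists_smul_add_smul_eq_of_finrank_eq_two hV hvw (f v)
  obtain ⟨u, hu⟩ := hf
  obtain ⟨p, q, rfl⟩ := exists_smul_add_smul_eq_of_finrank_eq_two hV hvw u
  simp only [map_add, map_smul, hfw, ← hfv] at hu
  by_cases hcb : c = b
  · subst hcb
    have hc : c ≠ 0 := by
      rintro rfl
      exact hu (by module)
    by_cases hd : d = 0
    · subst hd
      exact ⟨v, w, c, hc, hvw, .inl ⟨c, by rw [← hfv]; module, hfw⟩⟩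
    · refine ⟨v, (d / c) • w, c, hc, ?_, .inr ⟨?_, ?_⟩⟩
      · rw [LinearIndependent.pair_iff] at hvw ⊢
        intro s t hst
        have := hvw s (t * (d / c)) (by rw [← hst]; module)
        simpa [hc, hd] using this
      · rw [← hfv, smul_add, smul_smul, mul_div_cancel₀ _ hc]
      · rw [map_smul, hfw, smul_comm]
  · have hcb' : c - b ≠ 0 := sub_ne_zero.2 hcb
    have hfv' : f (v + (d / (c - b)) • w) = c • (v + (d / (c - b)) • w) := by
      rw [map_add, map_smul, hfw, ← hfv]
      match_scalars
      · ring
      · field_simp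
        ring
    have hvw' : LinearIndependent K ![v + (d / (c - b)) • w, w] := by
      rw [LinearIndependent.pair_iff] at hvw ⊢
      intro s t hst
      obtain ⟨h1, h2⟩ := hvw s (t + s * (d / (c - b))) (by rw [← hst]; module)
      subst h1
      simpa using h2
    by_cases hc : c = 0
    · exact ⟨w, _, b, fun hb0 => hcb (hc.trans hb0.symm), LinearIndependent.pair_symm_iff.1 hvw',
        .inl ⟨c, hfw, hfv'⟩⟩
    · exact ⟨_, w, c, hc, hvw', .inl ⟨b, hfv', hfw⟩⟩

/-- The left and right multiplications by `x` on the nilradical, together with the square `s` of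
`x`, can be put in normal form by changing the basis of the nilradical and replacing `x` by
`c • x + t`. -/
theorem exists_normal_form [IsAlgClosed K] (hV : Module.finrank K V = 2)
    (l r : Module.End K V) (s : V) (hcomm : ∀ u, l (r u) = r (l u))
    (hr : ∀ u, r (r u) + l (r u) = 0) (hrs : r s = 0) (hl : ∃ u, l (l u) ≠ 0)
    (hlie : r = -l → s ≠ 0) :
    ∃ (m : Fin 2 → V) (c : K) (t : V) (L R : Matrix (Fin 2) (Fin 2) K) (σ : Fin 2 → K),
      LinearIndependent K m ∧ c ≠ 0 ∧
      (∀ i, c • l (m i) = ∑ j, L i j • m j) ∧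
      (∀ i, c • r (m i) = ∑ j, R i j • m j) ∧
      (c * c) • s + c • (l t + r t) = σ 0 • m 0 + σ 1 • m 1 ∧
      ((R = 0 ∧ L = !![1, 0; 0, 0] ∧ σ 0 = 0) ∨
       (∃ a : K, a ≠ 0 ∧ R = 0 ∧ L = !![1, 0; 0, a] ∧ σ 0 = 0 ∧ σ 1 = 0) ∨
       (R = 0 ∧ L = !![1, 1; 0, 1] ∧ σ 0 = 0 ∧ σ 1 = 0) ∨
       (∃ a : K, a ≠ 0 ∧ R = !![1, 0; 0, 0] ∧ L = !![-1, 0; 0, a] ∧ σ 1 = 0) ∨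
       (R = !![1, 0; 0, 0] ∧ L = -R ∧ ¬ (σ 0 = 0 ∧ σ 1 = 0))) := by
  by_cases hr0 : r = 0
  · subst hr0
    obtain ⟨v, w, c, hc, hvw, -, ⟨a, hv, hw⟩ | ⟨hv, hw⟩⟩ :=
      exists_jordan_pair_of_not_nilpotent hV l hl
    all_goals obtain ⟨p, q, rfl⟩ := exists_smul_add_smul_eq_of_finrank_eq_two hV hvw s
    · by_cases ha : a = 0
      · subst ha
        refine ⟨![v, w], c⁻¹, (-(c⁻¹ * c⁻¹ * p)) • v, !![1, 0; 0, 0], 0, ![0, c⁻¹ * c⁻¹ * q],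
          hvw, inv_ne_zero hc, ?_, ?_, ?_, .inl ⟨rfl, rfl, rfl⟩⟩
        · simp [Fin.forall_fin_two, hv, hw, smul_smul, hc]
        · simp
        · simp only [map_smul, hv, LinearMap.zero_apply, Matrix.cons_val_zero,
            Matrix.cons_val_one]
          match_scalars <;> field_simp
          ring
      · refine ⟨![v, w], c⁻¹, (-(c⁻¹ * c⁻¹ * p)) • v + (-(c⁻¹ * a⁻¹ * q)) • w,
          !![1, 0; 0, c⁻¹ * a], 0, 0, hvw, inv_ne_zero hc, ?_, ?_, ?_,
          .inr (.inl ⟨_, mul_ne_zero (inv_ne_zero hc) ha, rfl, rfl, rfl, rfl⟩)⟩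
        · simp [Fin.forall_fin_two, hv, hw, smul_smul, hc]
        · simp
        · simp only [map_add, map_smul, hv, hw, LinearMap.zero_apply, Pi.zero_apply]
          match_scalars <;> field_simp <;> ring
    · refine ⟨![v, w], c⁻¹, (-(c⁻¹ * c⁻¹ * p)) • v + (c⁻¹ * c⁻¹ * (p - q)) • w,
        !![1, 1; 0, 1], 0, 0, hvw, inv_ne_zero hc, ?_, ?_, ?_,
        .inr (.inr (.inl ⟨rfl, rfl, rfl, rfl⟩))⟩
      · simp [Fin.forall_fin_two, hv, hw, smul_smul, hc]
      · simp
      · simp only [map_add, map_smul, hv, hw, LinearMap.zero_apply, Pi.zero_apply]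
        match_scalars <;> field_simp <;> ring
  have hrr : ∃ u, r (r u) ≠ 0 := by
    by_contra! hrr
    have hlr : ∀ u, l (r u) = 0 := fun u => by simpa [hrr] using hr u
    obtain ⟨u, hu⟩ : ∃ u, r u ≠ 0 := by
      by_contra! h
      exact hr0 (LinearMap.ext h)
    have hind : LinearIndependent K ![u, r u] := by
      rw [LinearIndependent.pair_iff]
      intro a b hab
      have ha : a = 0 := by simpa [hrr, hu] using congrArg r hab
      subst ha
      simpa [hu] using hab
    obtain ⟨a, b, hlu⟩ := exists_smul_add_smul_eq_of_finrank_eq_two hV hind (l u)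
    have ha : a = 0 := by
      have := congrArg r hlu
      simpa [hrr, hu, ← hcomm, hlr] using this
    subst ha
    obtain ⟨y, hy⟩ := hl
    obtain ⟨p, q, rfl⟩ := exists_smul_add_smul_eq_of_finrank_eq_two hV hind y
    exact hy (by simp [hlr, ← hlu])
  have hinj : ¬ Function.Injective r := fun h => by
    refine hlie (LinearMap.ext fun u => ?_) (h (by rw [hrs, map_zero]))
    have h1 : r (r u + l u) = 0 := by rw [map_add, ← hcomm, hr]
    rw [LinearMap.neg_apply]
    exact eq_neg_of_add_eq_zero_left (h (h1.trans (map_zero r).symm))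
  have hker : ∃ u, r u = 0 ∧ u ≠ 0 := by
    by_contra! h
    exact hinj ((injective_iff_map_eq_zero r).2 h)
  obtain ⟨u, hu, hu0⟩ := hker
  obtain ⟨v, w, c, hc, hvw, -, h⟩ := exists_jordan_pair_of_not_nilpotent hV r hrr
  have hvw' := LinearIndependent.pair_iff.1 hvw
  obtain ⟨hv, hw⟩ : r v = c • v ∧ r w = 0 := by
    obtain ⟨p, q, rfl⟩ := exists_smul_add_smul_eq_of_finrank_eq_two hV hvw u
    rw [map_add, map_smul, map_smul] at hu
    rcases h with ⟨a, hv, hw⟩ | ⟨hv, hw⟩ <;> rw [hv, hw] at hu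
    · obtain ⟨hp, hq⟩ := hvw' (p * c) (q * a) (by rw [← hu]; module)
      have hp : p = 0 := by simpa [hc] using hp
      subst hp
      have hq0 : q ≠ 0 := by
        rintro rfl
        simp at hu0
      have ha : a = 0 := by simpa [hq0] using hq
      exact ⟨hv, by rw [hw, ha, zero_smul]⟩
    · obtain ⟨hp, hq⟩ := hvw' (p * c) (p * c + q * c) (by rw [← hu]; module)
      have hp : p = 0 := by simpa [hc] using hp
      subst hp
      have hq : q = 0 := by simpa [hc] using hq
      subst hq
      simp at hu0
  have hlv : l v = -(c • v) := by
    have := hr v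
    rw [hv, map_smul, map_smul, hv, ← smul_add, smul_eq_zero] at this
    exact eq_neg_of_add_eq_zero_right (this.resolve_left hc)
  obtain ⟨a, hlw⟩ : ∃ a : K, l w = a • w := by
    obtain ⟨p, q, hpq⟩ := exists_smul_add_smul_eq_of_finrank_eq_two hV hvw (l w)
    have h0 : r (l w) = 0 := by rw [← hcomm, hw, map_zero]
    rw [← hpq, map_add, map_smul, map_smul, hv, hw] at h0
    have hp := (hvw' (p * c) 0 (by rw [← h0]; module)).1
    have hp : p = 0 := by simpa [hc] using hp
    exact ⟨q, by rw [← hpq, hp]; module⟩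
  obtain ⟨q, rfl⟩ : ∃ q : K, q • w = s := by
    obtain ⟨p, q, rfl⟩ := exists_smul_add_smul_eq_of_finrank_eq_two hV hvw s
    rw [map_add, map_smul, map_smul, hv, hw] at hrs
    have hp := (hvw' (p * c) 0 (by rw [← hrs]; module)).1
    have hp : p = 0 := by simpa [hc] using hp
    exact ⟨q, by rw [hp]; module⟩
  by_cases ha : a = 0
  · subst ha
    have hq : q ≠ 0 := by
      rintro rfl
      refine hlie (LinearMap.ext fun y => ?_) (zero_smul K w)
      obtain ⟨i, j, rfl⟩ := exists_smul_add_smul_eq_of_finrank_eq_two hV hvw y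
      simp [hv, hw, hlv, hlw]
    refine ⟨![v, w], c⁻¹, 0, -!![1, 0; 0, 0], !![1, 0; 0, 0], ![0, c⁻¹ * c⁻¹ * q],
      hvw, inv_ne_zero hc, ?_, ?_, ?_, .inr (.inr (.inr (.inr ⟨rfl, rfl, ?_⟩)))⟩
    · simp [Fin.forall_fin_two, hlv, hlw, smul_smul, hc]
    · simp [Fin.forall_fin_two, hv, hw, smul_smul, hc]
    · simp [smul_smul]
    · simp [hc, hq]
  · refine ⟨![v, w], c⁻¹, (-(c⁻¹ * a⁻¹ * q)) • w, !![-1, 0; 0, c⁻¹ * a], !![1, 0; 0, 0], 0,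
      hvw, inv_ne_zero hc, ?_, ?_, ?_,
      .inr (.inr (.inr (.inl ⟨_, mul_ne_zero (inv_ne_zero hc) ha, rfl, rfl, rfl⟩)))⟩
    · simp [Fin.forall_fin_two, hlv, hlw, smul_smul, hc]
    · simp [Fin.forall_fin_two, hv, hw, smul_smul, hc]
    · simp only [map_smul, hlw, hw, Pi.zero_apply]
      match_scalars <;> field_simp
      ring

end PlaneEndomorphisms


open BigOperators

/-- The left-nested bracket `[y₀,[y₁,...,[y_{m-1}, z]...]]` in a (Leibniz) algebra
with bracket `B`. -/
def leftNest {g : Type*} (B : g → g → g) : List g → g → g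
  | [], z => z
  | y :: ys, z => B y (leftNest B ys z)

/-- Classification of non-Lie solvable Leibniz algebras `L(2,1)`: a 3-dimensional
non-Lie, non-nilpotent Leibniz algebra over `ℂ` with a 2-dimensional abelian subspace
`N = span{n₁,n₂} ⊇ [g,g]` has a basis `{m₁, m₂, x}` with `m₁, m₂` spanning `N` in which
the structure constants belong to one of the five listed families. -/
theorem classification_L21_nonLie
    {g : Type*} [AddCommGroup g] [Module ℂ g]
    (B : g →ₗ[ℂ] g →ₗ[ℂ] g)
    (leib : ∀ x y z : g, B x (B y z) = B (B x y) z + B y (B x z))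
    (hdim : Module.finrank ℂ g = 3)
    (hnotLie : ¬ ∀ u v : g, B u v = - B v u)
    (hnotNilp : ¬ ∃ k : ℕ, ∀ (ys : List g) (z : g), ys.length = k →
      leftNest (fun u v => B u v) ys z = 0)
    (n : Fin 2 → g)
    (hindep : LinearIndependent ℂ n)
    (habelian : ∀ i j, B (n i) (n j) = 0)
    (hcl : ∀ u v : g, B u v ∈ Submodule.span ℂ (Set.range n)) :
    ∃ (m : Fin 2 → g) (x : g) (L R : Matrix (Fin 2) (Fin 2) ℂ) (σ : Fin 2 → ℂ),
      Submodule.span ℂ (Set.range m) = Submodule.span ℂ (Set.range n) ∧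
      LinearIndependent ℂ ![m 0, m 1, x] ∧
      Submodule.span ℂ {m 0, m 1, x} = ⊤ ∧
      (∀ i, B x (m i) = ∑ j, L i j • m j) ∧
      (∀ i, B (m i) x = ∑ j, R i j • m j) ∧
      B x x = σ 0 • m 0 + σ 1 • m 1 ∧
      ((R = 0 ∧ L = !![1, 0; 0, 0] ∧ σ 0 = 0) ∨
       (∃ a : ℂ, a ≠ 0 ∧ R = 0 ∧ L = !![1, 0; 0, a] ∧ σ 0 = 0 ∧ σ 1 = 0) ∨
       (R = 0 ∧ L = !![1, 1; 0, 1] ∧ σ 0 = 0 ∧ σ 1 = 0) ∨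
       (∃ a : ℂ, a ≠ 0 ∧ R = !![1, 0; 0, 0] ∧ L = !![-1, 0; 0, a] ∧ σ 1 = 0) ∨
       (R = !![1, 0; 0, 0] ∧ L = -R ∧ ¬ (σ 0 = 0 ∧ σ 1 = 0))) := by
  set N := Submodule.span ℂ (Set.range n)
  have : Module.Finite ℂ g := Module.finite_of_finrank_eq_succ hdim
  have hN2 : Module.finrank ℂ N = 2 := by simpa using finrank_span_eq_card hindep
  have hBN : ∀ u ∈ N, ∀ v ∈ N, B u v = 0 := by
    intro u hu v hv
    induction hu using Submodule.span_induction with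
    | zero => simp
    | add a b _ _ ha hb => simp [ha, hb]
    | smul a b _ hb => simp [hb]
    | mem a ha =>
      obtain ⟨i, rfl⟩ := ha
      induction hv using Submodule.span_induction with
      | zero => simp
      | add a b _ _ ha hb => simp [ha, hb]
      | smul a b _ hb => simp [hb]
      | mem a ha =>
        obtain ⟨j, rfl⟩ := ha
        exact habelian i j
  obtain ⟨x, hx⟩ : ∃ x, x ∉ N := by
    by_contra! h
    have := finrank_top ℂ g
    rw [← (Submodule.eq_top_iff'.2 h : N = ⊤)] at this
    omega
  have hdecomp : ∀ u : g, ∃ (b : ℂ) (t : N), u = b • x + t := by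
    have htop : N ⊔ Submodule.span ℂ {x} = ⊤ := by
      apply Submodule.eq_top_of_finrank_eq
      have := Submodule.finrank_lt_finrank_of_lt
        (Submodule.lt_sup_iff_notMem.2 hx : N < N ⊔ Submodule.span ℂ {x})
      have := Submodule.finrank_le (N ⊔ Submodule.span ℂ {x})
      omega
    intro u
    obtain ⟨t, ht, y, hy, rfl⟩ := Submodule.mem_sup.1 (htop ▸ Submodule.mem_top : u ∈ _)
    obtain ⟨b, rfl⟩ := Submodule.mem_span_singleton.1 hy
    exact ⟨b, ⟨t, ht⟩, add_comm _ _⟩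
  let l : Module.End ℂ N := (B x ∘ₗ N.subtype).codRestrict N fun u => hcl x u
  let r : Module.End ℂ N := (B.flip x ∘ₗ N.subtype).codRestrict N fun u => hcl u x
  let s : N := ⟨B x x, hcl x x⟩
  have hl (u : N) : (l u : g) = B x u := rfl
  have hr (u : N) : (r u : g) = B u x := rfl
  have hs : (s : g) = B x x := rfl
  have hNN (u v : N) : B u v = 0 := hBN u u.2 v v.2
  have hcomm : ∀ u, l (r u) = r (l u) := by
    intro u
    apply Subtype.ext
    simpa [hl, hr, hBN u u.2 _ (hcl x x)] using leib x u x
  have hrr : ∀ u, r (r u) + l (r u) = 0 := by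
    intro u
    apply Subtype.ext
    simpa [hl, hr, hBN u u.2 _ (hcl x x)] using (leib u x x).symm
  have hrs : r s = 0 := by
    apply Subtype.ext
    simpa [hr, hs] using leib x x x
  have hll : ∃ u, l (l u) ≠ 0 := by
    by_contra! h
    refine hnotNilp ⟨3, fun ys z hys => ?_⟩
    obtain ⟨y₁, y₂, y₃, rfl⟩ := List.length_eq_three.1 hys
    have hB (y : g) : ∃ b : ℂ, ∀ u : N, B y u = b • (l u : g) := by
      obtain ⟨b, t, rfl⟩ := hdecomp y
      exact ⟨b, fun u => by simp [hl, hNN]⟩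
    obtain ⟨b₁, h₁⟩ := hB y₁
    obtain ⟨b₂, h₂⟩ := hB y₂
    have h₃ := h₂ ⟨B y₃ z, hcl _ _⟩
    simp only [leftNest]
    rw [h₃, map_smul, h₁, h]
    simp
  have hlie : r = -l → s ≠ 0 := by
    intro hrl hs0
    refine hnotLie fun u v => ?_
    obtain ⟨a, p, rfl⟩ := hdecomp u
    obtain ⟨b, q, rfl⟩ := hdecomp v
    have hrl' (u : N) : B u x = -B x u := congrArg N.subtype (LinearMap.congr_fun hrl u)
    have hxx : B x x = 0 := congrArg N.subtype hs0
    simp only [map_add, map_smul, LinearMap.add_apply, LinearMap.smul_apply, hNN, hrl', hxx]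
    module
  obtain ⟨m, c, t, L, R, σ, hm, hc, hL, hR, hσ, hfam⟩ :=
    exists_normal_form hN2 l r s hcomm hrr hrs hll hlie
  have hspan : Submodule.span ℂ (Set.range fun i => (m i : g)) = N := by
    have := congrArg (Submodule.map N.subtype)
      (hm.span_eq_top_of_card_eq_finrank (by simp [hN2]))
    rwa [Submodule.map_span, Submodule.map_top, Submodule.range_subtype, ← Set.range_comp]
      at this
  have hy : c • x + (t : g) ∉ N := fun h => hx <| by
    simpa [smul_smul, hc] using N.smul_mem c⁻¹ ((N.add_mem_iff_left t.2).1 h)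
  have hind : LinearIndependent ℂ ![(m 0 : g), (m 1 : g), c • x + (t : g)] := by
    have := (hm.map' N.subtype N.ker_subtype).finSnoc (x := c • x + (t : g)) (by
      rwa [show (N.subtype ∘ m) = fun i => (m i : g) from rfl, hspan])
    have heq : Fin.snoc (N.subtype ∘ m) (c • x + (t : g)) =
        ![(m 0 : g), (m 1 : g), c • x + (t : g)] := by
      ext i
      fin_cases i <;> rfl
    exact heq ▸ this
  refine ⟨fun i => m i, c • x + t, L, R, σ, hspan, hind, ?_, fun i => ?_, fun i => ?_, ?_, hfam⟩
  · rw [← hind.span_eq_top_of_card_eq_finrank (by simp [hdim])]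
    congr 1
    simp only [Matrix.range_cons, Matrix.range_empty, Set.union_empty, Set.singleton_union]
  · simpa [hl, hNN] using congrArg N.subtype (hL i)
  · simpa [hr, hNN] using congrArg N.subtype (hR i)
  · have := congrArg N.subtype hσ
    simp only [map_add, map_smul, Submodule.subtype_apply, hl, hr, hs] at this
    rw [← this]
    simp only [map_add, map_smul, LinearMap.add_apply, LinearMap.smul_apply, hNN]
    module
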